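/- arXiv:2506.00456 — 4 statements merged into one kernel-verified Lean document; each statement's English description precedes it below -/
import Mathlib

section
/- Let d ≥ 2 and n > m ≥ 1 be integers. Let A and I be finite types with |A| = d^{n−m} and |I| = d^m, let a be a permutation of I, let b : I → Perm(A) be a family of permutations of A, and let σ be the permutation of A × I defined by σ(x, i) = (b_i(x), a(i)). If d is odd, then sign(σ) = sign(a) · ∏_{i ∈ I} sign(b_i); if d is even, then sign(σ) = ∏_{i ∈ I} sign(b_i). -/
/-- The sign of the permutation `(x, i) ↦ (b i x, a i)` of `A × I`. -/
theorem Equiv.Perm.sign_of_apply_prod {A I : Type*} [Fintype A] [DecidableEq A] [Fintype I]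
    [DecidableEq I] (a : Equiv.Perm I) (b : I → Equiv.Perm A) (σ : Equiv.Perm (A × I))
    (hσ : ∀ x i, σ (x, i) = (b i x, a i)) :
    Equiv.Perm.sign σ =
      Equiv.Perm.sign a ^ Fintype.card A * ∏ i : I, Equiv.Perm.sign (b i) := by
  have h : σ = Equiv.prodCongrRight (fun _ : A => a) * Equiv.prodCongrLeft b := by
    ext1 ⟨x, i⟩
    simp [hσ]
  rw [h, Equiv.Perm.sign_mul, Equiv.Perm.sign_prodCongrRight, Equiv.Perm.sign_prodCongrLeft]
  simp

/-- The sign of an element `((b_i)_{i ∈ I}; a)` of the wreath product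
`Perm A ≀ Perm I`, acting on `A × I` by `σ(x, i) = (b_i x, a i)`, where `|A| = d^{n-m}` and
`|I| = d^m`: for odd `d` it is `sign a · ∏ i, sign (b i)`, and for even `d` it is
`∏ i, sign (b i)`. -/
theorem wreath_sign_formula (d n m : ℕ) (hd : 2 ≤ d) (hm : 1 ≤ m) (hmn : m < n)
    (A I : Type) [Fintype A] [DecidableEq A] [Fintype I] [DecidableEq I]
    (hA : Fintype.card A = d ^ (n - m)) (hI : Fintype.card I = d ^ m)
    (a : Equiv.Perm I) (b : I → Equiv.Perm A)
    (σ : Equiv.Perm (A × I)) (hσ : ∀ x i, σ (x, i) = (b i x, a i)) :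
    (Odd d → Equiv.Perm.sign σ = Equiv.Perm.sign a * ∏ i : I, Equiv.Perm.sign (b i)) ∧
    (Even d → Equiv.Perm.sign σ = ∏ i : I, Equiv.Perm.sign (b i)) := by
  rw [Equiv.Perm.sign_of_apply_prod a b σ hσ, hA]
  refine ⟨fun h => ?_, fun h => ?_⟩
  · rw [Int.units_pow_eq_pow_mod_two, Nat.odd_iff.mp h.pow, pow_one]
  · rw [Int.units_pow_eq_pow_mod_two,
      Nat.even_iff.mp (h.pow_of_ne_zero (Nat.sub_ne_zero_of_lt hmn)), pow_zero, one_mul]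
end

section
/- Let N and H be groups, let φ : H → Aut(N) be a group homomorphism, and let G = N ⋊_φ H be the semidirect product. Then the abelianization of G is isomorphic to ((Abelianization N) ⧸ R) × (Abelianization H), where R is the subgroup of Abelianization N generated by all elements [φ(h)(n)] · [n]⁻¹ for h ∈ H and n ∈ N, and [·] denotes the image in Abelianization N (so (Abelianization N) ⧸ R is the group of coinvariants of the induced H-action on Abelianization N). -/
namespace SemidirectProduct

variable {N H : Type*} [Group N] [Group H] (φ : H →* MulAut N)

/-- The subgroup of `Abelianization N` whose quotient is the group of coinvariants. -/
def abelianizationCoinvariantsKer : Subgroup (Abelianization N) :=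
  Subgroup.closure {x : Abelianization N | ∃ (h : H) (n : N),
    x = Abelianization.of (φ h n) * (Abelianization.of n)⁻¹}

theorem mk_of_aut (h : H) (n : N) :
    (QuotientGroup.mk' (abelianizationCoinvariantsKer φ)) (Abelianization.of (φ h n)) =
      QuotientGroup.mk' (abelianizationCoinvariantsKer φ) (Abelianization.of n) := by
  rw [← mul_inv_eq_one, ← map_inv, ← map_mul, ← MonoidHom.mem_ker, QuotientGroup.ker_mk']
  exact Subgroup.subset_closure ⟨h, n, rfl⟩

theorem abelianizationOf_inl_aut (h : H) (n : N) :
    Abelianization.of (inl (φ h n) : N ⋊[φ] H) = Abelianization.of (inl n) := by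
  simp [inl_aut, mul_comm]

/-- The map from the abelianization of a semidirect product to the product of the coinvariants
of `Abelianization N` with `Abelianization H`. -/
def abelianizationToProd : Abelianization (N ⋊[φ] H) →*
    (Abelianization N ⧸ abelianizationCoinvariantsKer φ) × Abelianization H :=
  (Abelianization.lift (lift ((QuotientGroup.mk' _).comp Abelianization.of) 1 fun h => by
    ext n
    simpa using mk_of_aut φ h n)).prod (Abelianization.map rightHom)

/-- The map to the abelianization of a semidirect product from the product of the coinvariants
of `Abelianization N` with `Abelianization H`. -/
def abelianizationOfProd : (Abelianization N ⧸ abelianizationCoinvariantsKer φ) ×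
    Abelianization H →* Abelianization (N ⋊[φ] H) :=
  (QuotientGroup.lift (abelianizationCoinvariantsKer φ) (Abelianization.map inl) (by
    rw [abelianizationCoinvariantsKer, Subgroup.closure_le]
    rintro _ ⟨h, n, rfl⟩
    simp [MonoidHom.mem_ker, abelianizationOf_inl_aut])).coprod (Abelianization.map inr)

/-- The abelianization of a semidirect product is the product of the coinvariants of
`Abelianization N` with `Abelianization H`. -/
def abelianizationEquivProd : Abelianization (N ⋊[φ] H) ≃*
    (Abelianization N ⧸ abelianizationCoinvariantsKer φ) × Abelianization H :=
  MonoidHom.toMulEquiv (abelianizationToProd φ) (abelianizationOfProd φ)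
    (by
      refine Abelianization.hom_ext _ _ (hom_ext ?_ ?_) <;> ext x <;>
        simp [abelianizationToProd, abelianizationOfProd])
    (by
      ext ⟨x, y⟩ : 1
      induction x using QuotientGroup.induction_on with | H x
      induction x using QuotientGroup.induction_on with | H n
      induction y using QuotientGroup.induction_on with | H h
      change abelianizationToProd φ (abelianizationOfProd φ
        (QuotientGroup.mk (Abelianization.of n), Abelianization.of h)) =
          (QuotientGroup.mk (Abelianization.of n), Abelianization.of h)
      simp [abelianizationToProd, abelianizationOfProd])

end SemidirectProduct


/-- For a semidirect product `G = N ⋊[φ] H`, the abelianization of `G` is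
isomorphic to `(N^{ab})_H × H^{ab}`, where `(N^{ab})_H` is the group of coinvariants, i.e. the
quotient of `N^{ab}` by the subgroup generated by all `[φ(h)(n)] · [n]⁻¹`. -/
theorem abelianization_semidirectProduct (N H : Type) [Group N] [Group H]
    (φ : H →* MulAut N)
    (R : Subgroup (Abelianization N))
    (hR : R = Subgroup.closure
      {x : Abelianization N | ∃ (h : H) (n : N),
        x = Abelianization.of (φ h n) * (Abelianization.of n)⁻¹}) :
    Nonempty (Abelianization (N ⋊[φ] H) ≃* ((Abelianization N ⧸ R) × Abelianization H)) := by
  subst hR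
  exact ⟨SemidirectProduct.abelianizationEquivProd φ⟩
end

section
/- Let H and G be groups, let I be a finite nonempty type, and let G act faithfully and transitively on I. Then the abelianization of the wreath product (I → H) ⋊ G (where G acts on I → H by permuting coordinates) is isomorphic to (Abelianization G) × (Abelianization H). -/
/-- The coordinate-permutation action of a group `G` acting on an index type `I`, on the direct
product `I → H`: this is the action used to form the wreath product `H ≀_I G = (I → H) ⋊ G`. -/
def wreathAction (G I H : Type) [Group G] [Group H] [MulAction G I] :
    G →* MulAut (I → H) where
  toFun g :=
    { toFun := fun b i => b (g⁻¹ • i)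
      invFun := fun b i => b (g • i)
      left_inv := fun b => funext fun i => by simp
      right_inv := fun b => funext fun i => by simp
      map_mul' := fun b c => rfl }
  map_one' := by
    apply MulEquiv.ext; intro b; funext i; simp
  map_mul' g₁ g₂ := by
    apply MulEquiv.ext; intro b; funext i
    simp [mul_smul]

open SemidirectProduct

/-- The homomorphism from the wreath product to `G^{ab} × H^{ab}` that multiplies the coordinates of
the base together in `H^{ab}`. -/
def wreathToProd (G I H : Type) [Group G] [Group H] [Fintype I] [MulAction G I] :
    ((I → H) ⋊[wreathAction G I H] G) →* Abelianization G × Abelianization H :=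
  (Abelianization.of.comp rightHom).prod <|
    lift
      { toFun := fun b => ∏ i, Abelianization.of (b i)
        map_one' := by simp
        map_mul' := fun b c => by simp [Finset.prod_mul_distrib] }
      1
      (fun g => MonoidHom.ext fun b => by
        simpa [wreathAction] using
          Equiv.prod_comp (MulAction.toPerm g⁻¹) fun i => Abelianization.of (b i))

@[simp]
theorem wreathToProd_inl {G I H : Type} [Group G] [Group H] [Fintype I] [MulAction G I]
    (b : I → H) :
    wreathToProd G I H (inl b) = (1, ∏ i, Abelianization.of (b i)) := by
  simp [wreathToProd]

@[simp]
theorem wreathToProd_inr {G I H : Type} [Group G] [Group H] [Fintype I] [MulAction G I] (g : G) :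
    wreathToProd G I H (inr g) = (Abelianization.of g, 1) := by
  simp [wreathToProd]

theorem wreathAction_mulSingle {G I H : Type} [Group G] [Group H] [DecidableEq I] [MulAction G I]
    (g : G) (i : I) (h : H) :
    wreathAction G I H g (Pi.mulSingle i h) = Pi.mulSingle (g • i) h := by
  funext j
  simp [wreathAction, Pi.mulSingle_apply, inv_smul_eq_iff]

@[simp]
theorem prod_of_mulSingle {H I : Type*} [Group H] [Fintype I] [DecidableEq I] (i : I) (h : H) :
    ∏ j, Abelianization.of ((Pi.mulSingle i h : I → H) j) = Abelianization.of h := by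
  simp [Pi.mulSingle_apply, apply_ite Abelianization.of]

/-- Elements of the base conjugate under the top group agree in the abelianization. -/
theorem Abelianization.of_inl_aut {N G : Type*} [Group N] [Group G] {φ : G →* MulAut N}
    (g : G) (n : N) :
    Abelianization.of (inl (φ g n) : N ⋊[φ] G) = Abelianization.of (inl n) := by
  rw [inl_aut, map_mul, map_mul, mul_right_comm, ← map_mul, ← map_mul, map_inv,
    mul_inv_cancel, one_mul]

/-- The homomorphism from `G^{ab} × H^{ab}` to the abelianized wreath product that puts `H` in the
coordinate `i`. -/
def prodToWreath (G H : Type) {I : Type} [Group G] [Group H] [DecidableEq I] [MulAction G I]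
    (i : I) :
    Abelianization G × Abelianization H →* Abelianization ((I → H) ⋊[wreathAction G I H] G) :=
  (Abelianization.map inr).coprod
    (Abelianization.map (inl.comp (MonoidHom.mulSingle (fun _ => H) i)))

/-- If a group `G` acts faithfully and transitively on a finite nonempty type
`I`, then the abelianization of the wreath product `H ≀_I G = (I → H) ⋊ G` is isomorphic to
`G^{ab} × H^{ab}`. -/
theorem abelianization_wreathProduct (G I H : Type) [Group G] [Group H]
    [Fintype I] [Nonempty I] [MulAction G I]
    (hfaithful : FaithfulSMul G I) (htrans : MulAction.IsPretransitive G I) :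
    Nonempty (Abelianization ((I → H) ⋊[wreathAction G I H] G) ≃*
      (Abelianization G × Abelianization H)) := by
  classical
  let i₀ := Classical.arbitrary I
  refine ⟨MonoidHom.toMulEquiv (Abelianization.lift (wreathToProd G I H)) (prodToWreath G H i₀)
    ?_ ?_⟩
  · refine Abelianization.hom_ext _ _ (SemidirectProduct.hom_ext ?_ ?_)
    · refine MonoidHom.pi_ext fun i h => ?_
      obtain ⟨g, rfl⟩ := MulAction.exists_smul_eq G i₀ i
      rw [← wreathAction_mulSingle]
      simp [Abelianization.of_inl_aut, prodToWreath]
    · ext g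
      simp [prodToWreath]
  · apply MonoidHom.ext
    rintro ⟨x, y⟩
    obtain ⟨g, hg : Abelianization.of g = x⟩ := QuotientGroup.mk_surjective x
    obtain ⟨h, hh : Abelianization.of h = y⟩ := QuotientGroup.mk_surjective y
    simp [prodToWreath, ← hg, ← hh]
end

section
/- Let K be a field of characteristic zero, let f ∈ K[X] have degree d ≥ 2 and leading coefficient a_f, let α ∈ K, and let n ≥ 2 be an integer. Then disc(f^n − α) = (−1)^{A(d,n)} · a_f^{d^{2n−1}−1} · d^{d^n} · disc(f^{n−1} − α)^d · ∏_c (f^n(c) − α), where the product runs over the roots c of f' in an algebraic closure of K counted with multiplicity, and A(d,n) = d^n(d^n−1)/2 + d^n(d^{n−1}−1)/2. Moreover (−1)^{A(d,n)} equals 1 if d is even or d ≡ 1 (mod 4), and equals −1 if d ≡ 3 (mod 4). -/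
open Polynomial

noncomputable section

namespace Arb

/-- The `n`-fold composite `f^n` of a polynomial (`f^0 = X`). -/
def fIter {K : Type} [Field K] (f : K[X]) : ℕ → K[X]
  | 0 => X
  | n + 1 => f.comp (fIter f n)

/-- The product `∏_{i < j} (r_i - r_j)^2` over the entries of a list. -/
def pairProd {F : Type} [Field F] (l : List F) : F :=
  ∏ i ∈ Finset.range l.length, ∏ j ∈ Finset.range i, (l.getD i 0 - l.getD j 0) ^ 2

/-- The discriminant of a polynomial `p` of degree `N` with leading coefficient `c` and roots
`r_1, …, r_N` (listed with multiplicity) in an algebraic closure of `K`: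
`disc p = c^{2N-2} · ∏_{i<j} (r_i - r_j)^2`, computed in the algebraic closure. -/
def polyDisc {K : Type} [Field K] (p : K[X]) : AlgebraicClosure K :=
  algebraMap K (AlgebraicClosure K) p.leadingCoeff ^ (2 * p.natDegree - 2) *
    pairProd ((p.map (algebraMap K (AlgebraicClosure K))).roots).toList

end Arb

namespace Arb

/-- Splitting off the first entry of the product over pairs. -/
lemma pairProd_cons {F : Type} [Field F] (a : F) (l : List F) :
    pairProd (a :: l) = pairProd l * (l.map fun b => (b - a) ^ 2).prod := by
  have h : (l.map fun b => (b - a) ^ 2).prod =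
      ∏ i ∈ Finset.range l.length, (l.getD i 0 - a) ^ 2 := by
    induction l with
    | nil => simp
    | cons b l ih => simp [Finset.prod_range_succ', ih, mul_comm]
  simp [pairProd, Finset.prod_range_succ', Finset.prod_mul_distrib, h]

/-- The product over pairs in terms of the derivative of the monic polynomial with given roots. -/
lemma prod_eval_derivative_eq_pairProd {F : Type} [Field F] (l : List F) :
    (l.map fun a => (derivative (l.map fun b => X - C b).prod).eval a).prod =
      (-1) ^ (l.length * (l.length - 1) / 2) * pairProd l := by
  induction l with
  | nil => simp [pairProd]
  | cons a l ih =>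
    set q := (l.map fun b => X - C b).prod with hq
    have hroot : ∀ b ∈ l, q.eval b = 0 := fun b hb => by
      rw [hq, eval_list_prod, List.map_map]
      exact List.prod_eq_zero (List.mem_map.2 ⟨b, hb, by simp⟩)
    have hqa : q.eval a = (-1) ^ l.length * (l.map fun b => b - a).prod := by
      rw [hq, eval_list_prod, List.map_map]
      clear * -
      induction l with
      | nil => simp
      | cons b l ih =>
        simp only [List.map_cons, List.prod_cons, ih, List.length_cons, Function.comp_apply,
          eval_sub, eval_X, eval_C]
        ring
    have htail : (l.map fun b => (derivative ((X - C a) * q)).eval b) =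
        l.map fun b => (b - a) * (derivative q).eval b :=
      List.map_congr_left fun b hb => by simp [derivative_mul, hroot b hb]
    have hexp : (l.length + 1) * (l.length + 1 - 1) / 2 =
        l.length * (l.length - 1) / 2 + l.length := by
      rw [← Finset.sum_range_id, ← Finset.sum_range_id, Finset.sum_range_succ]
    have hsq : (l.map fun b => (b - a) ^ 2).prod = (l.map fun b => b - a).prod ^ 2 := by
      simpa using Multiset.prod_map_pow (m := (l : Multiset F)) (f := fun b => b - a) (n := 2)
    rw [List.map_cons, List.prod_cons, List.map_cons, List.prod_cons, ← hq, htail,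
      List.prod_map_mul, ih, pairProd_cons, hsq, List.length_cons, hexp]
    simp only [derivative_mul, derivative_sub, derivative_X, derivative_C, eval_add, eval_mul,
      eval_sub, eval_X, eval_C, sub_self, zero_mul, add_zero, sub_zero, one_mul, hqa]
    ring

/-- The discriminant in terms of the values of the derivative at the roots. -/
lemma polyDisc_eq_prod_eval_derivative {K : Type} [Field K] (p : K[X]) (hp : 2 ≤ p.natDegree) :
    polyDisc p = (-1) ^ (p.natDegree * (p.natDegree - 1) / 2) *
      algebraMap K (AlgebraicClosure K) p.leadingCoeff ^ (p.natDegree - 2) *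
      ((p.map (algebraMap K (AlgebraicClosure K))).roots.map fun r =>
        (derivative (p.map (algebraMap K (AlgebraicClosure K)))).eval r).prod := by
  set P := p.map (algebraMap K (AlgebraicClosure K)) with hP
  have hsplit : P.Splits := IsAlgClosed.splits P
  have hlc : P.leadingCoeff = algebraMap K (AlgebraicClosure K) p.leadingCoeff :=
    leadingCoeff_map _
  have hcard : P.roots.toList.length = p.natDegree := by
    rw [Multiset.length_toList, ← hsplit.natDegree_eq_card_roots, natDegree_map]
  have hfac : P = C P.leadingCoeff * (P.roots.toList.map fun b => X - C b).prod := by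
    conv_lhs => rw [hsplit.eq_prod_roots]
    rw [← Multiset.prod_coe, ← Multiset.map_coe, Multiset.coe_toList]
  have hder : (P.roots.map fun r => (derivative P).eval r).prod = P.leadingCoeff ^ p.natDegree *
      (P.roots.toList.map fun r =>
        (derivative (P.roots.toList.map fun b => X - C b).prod).eval r).prod := by
    have : ∀ r, (derivative P).eval r = P.leadingCoeff *
        (derivative (P.roots.toList.map fun b => X - C b).prod).eval r := fun r => by
      conv_lhs => rw [hfac]
      rw [derivative_C_mul, eval_C_mul]
    simp only [this]
    rw [Multiset.prod_map_mul, Multiset.map_const', Multiset.prod_replicate,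
      ← Multiset.length_toList, hcard]
    conv_rhs => rw [← Multiset.prod_coe, ← Multiset.map_coe, Multiset.coe_toList]
  rw [hder, prod_eval_derivative_eq_pairProd, hcard, hlc, polyDisc, ← hP]
  obtain ⟨k, hk⟩ := Nat.exists_eq_add_of_le hp
  have hs : ((-1 : AlgebraicClosure K) ^ (p.natDegree * (p.natDegree - 1) / 2)) ^ 2 = 1 := by
    rw [← pow_mul, mul_comm, pow_mul]; simp
  rw [show 2 * p.natDegree - 2 = (p.natDegree - 2) + p.natDegree by lia]
  linear_combination (-algebraMap K (AlgebraicClosure K) p.leadingCoeff ^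
    (p.natDegree - 2 + p.natDegree) * pairProd P.roots.toList) * hs

/-- The product of a function of `F r` over the roots `r` of `Q ∘ F`. -/
lemma prod_map_roots_comp {L : Type} [Field L] [IsAlgClosed L] (Q F : L[X])
    (hF : F.natDegree ≠ 0) (g : L → L) :
    ((Q.comp F).roots.map fun r => g (F.eval r)).prod =
      (Q.roots.map g).prod ^ F.natDegree := by
  have hfib : ∀ q, F - C q ≠ 0 := fun q h => hF <| by
    rw [sub_eq_zero.1 h, natDegree_C]
  have hroots : (Q.comp F).roots = Q.roots.bind fun q => (F - C q).roots := by
    by_cases hQ : Q = 0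
    · simp [hQ]
    have hcomp : Q.comp F = C Q.leadingCoeff * (Q.roots.map fun q => F - C q).prod := by
      conv_lhs => rw [(IsAlgClosed.splits Q).eq_prod_roots]
      rw [mul_comp, C_comp, multiset_prod_comp, Multiset.map_map]
      simp
    rw [hcomp, roots_C_mul _ (leadingCoeff_ne_zero.2 hQ), roots_multiset_prod,
      Multiset.bind_map]
    simpa using fun q _ _ => hfib q
  rw [hroots, Multiset.map_bind, Multiset.prod_bind, ← Multiset.prod_map_pow]
  congr 1
  refine Multiset.map_congr rfl fun q _ => ?_
  have hconst : ((F - C q).roots.map fun r => g (F.eval r)) =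
      (F - C q).roots.map fun _ => g q :=
    Multiset.map_congr rfl fun r hr => by
      have := (mem_roots'.1 hr).2
      rw [IsRoot.def, eval_sub, eval_C, sub_eq_zero] at this
      rw [this]
  rw [hconst, Multiset.map_const', Multiset.prod_replicate,
    ← (IsAlgClosed.splits (F - C q)).natDegree_eq_card_roots, natDegree_sub_C]

/-- Exchanging the roles of two polynomials in the product of values at roots. -/
lemma prod_eval_roots_comm {L : Type} [Field L] [IsAlgClosed L] (p g : L[X]) :
    p.leadingCoeff ^ g.natDegree * (p.roots.map g.eval).prod =
      (-1) ^ (p.natDegree * g.natDegree) *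
        (g.leadingCoeff ^ p.natDegree * (g.roots.map p.eval).prod) := by
  rw [← resultant_eq_prod_eval p g _ le_rfl (IsAlgClosed.splits p),
    ← resultant_eq_prod_eval g p _ le_rfl (IsAlgClosed.splits g), resultant_comm]

lemma natDegree_fIter {K : Type} [Field K] (f : K[X]) (n : ℕ) :
    (fIter f n).natDegree = f.natDegree ^ n := by
  induction n with
  | zero => simp [fIter]
  | succ n ih => rw [fIter, natDegree_comp, ih, pow_succ']

lemma fIter_succ_eq_comp_right {K : Type} [Field K] (f : K[X]) (n : ℕ) :
    fIter f (n + 1) = (fIter f n).comp f := by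
  induction n with
  | zero => simp [fIter]
  | succ n ih => exact (congrArg f.comp ih).trans (comp_assoc f (fIter f n) f).symm

lemma leadingCoeff_fIter {K : Type} [Field K] (f : K[X]) (hf : f.natDegree ≠ 0) (n : ℕ) :
    (fIter f n).leadingCoeff = f.leadingCoeff ^ (∑ i ∈ Finset.range n, f.natDegree ^ i) := by
  induction n with
  | zero => simp [fIter]
  | succ n ih =>
    rw [fIter_succ_eq_comp_right, leadingCoeff_comp hf, ih, natDegree_fIter, ← pow_add,
      Finset.sum_range_succ]

lemma leadingCoeff_sub_C {K : Type} [Field K] (p : K[X]) (hp : p.natDegree ≠ 0) (α : K) :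
    (p - C α).leadingCoeff = p.leadingCoeff :=
  leadingCoeff_sub_of_degree_lt <|
    degree_C_le.trans_lt <| natDegree_pos_iff_degree_pos.1 (Nat.pos_of_ne_zero hp)

/-- The discriminant of a composite `Q ∘ f`, up to normalization by leading coefficients. -/
lemma polyDisc_comp {K : Type} [Field K] [CharZero K] (Q f : K[X]) (hf : 2 ≤ f.natDegree)
    (hQ : 2 ≤ Q.natDegree) :
    algebraMap K (AlgebraicClosure K) (Q.leadingCoeff ^ (f.natDegree * (Q.natDegree - 2))) *
        polyDisc (Q.comp f) =
      (-1) ^ (Q.natDegree * f.natDegree * (Q.natDegree * f.natDegree - 1) / 2 +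
          Q.natDegree * f.natDegree * (Q.natDegree - 1) / 2 +
          Q.natDegree * f.natDegree * (f.natDegree - 1)) *
        algebraMap K (AlgebraicClosure K) ((Q.comp f).leadingCoeff ^
            (Q.natDegree * f.natDegree - 2 - (f.natDegree - 1)) *
          f.leadingCoeff ^ (Q.natDegree * f.natDegree)) *
        (f.natDegree : AlgebraicClosure K) ^ (Q.natDegree * f.natDegree) *
        polyDisc Q ^ f.natDegree *
        (((derivative f).map (algebraMap K (AlgebraicClosure K))).roots.map fun c =>
          aeval c (Q.comp f)).prod := by
  set φ := algebraMap K (AlgebraicClosure K) with hφ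
  have hN : (Q.comp f).natDegree = Q.natDegree * f.natDegree := natDegree_comp
  obtain ⟨k, hk⟩ : ∃ k, Q.natDegree * f.natDegree - 2 = k + (f.natDegree - 1) := by
    refine Nat.exists_eq_add_of_le' ?_
    have : 2 * f.natDegree ≤ Q.natDegree * f.natDegree := Nat.mul_le_mul_right _ hQ
    lia
  have hdeg' : (derivative f).natDegree = f.natDegree - 1 := natDegree_derivative _
  have hlc' : (derivative f).leadingCoeff = f.leadingCoeff * f.natDegree := by
    rw [leadingCoeff, hdeg', coeff_derivative, Nat.sub_add_cancel (by lia), leadingCoeff,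
      Nat.cast_sub (by lia)]
    simp
  have hsign : Q.natDegree * f.natDegree * (Q.natDegree - 1) / 2 =
      Q.natDegree * (Q.natDegree - 1) / 2 * f.natDegree := by
    rw [Nat.div_mul_right_comm (Nat.even_mul_pred_self _).two_dvd, mul_right_comm]
  have hswap := prod_eval_roots_comm ((Q.comp f).map φ) ((derivative f).map φ)
  have hchain := prod_map_roots_comp (Q.map φ) (f.map φ) (by rw [natDegree_map]; lia)
    (fun x => (derivative (Q.map φ)).eval x)
  have hcrit : (((derivative f).map φ).roots.map fun c => aeval c (Q.comp f)) =
      ((derivative f).map φ).roots.map ((Q.comp f).map φ).eval :=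
    Multiset.map_congr rfl fun c _ => by rw [eval_map_algebraMap]
  have hvals : (((Q.comp f).map φ).roots.map fun r =>
        (derivative ((Q.comp f).map φ)).eval r).prod =
      (((Q.comp f).map φ).roots.map ((derivative f).map φ).eval).prod *
        (((Q.comp f).map φ).roots.map fun r =>
          (derivative (Q.map φ)).eval ((f.map φ).eval r)).prod := by
    rw [← Multiset.prod_map_mul]
    congr 1
    refine Multiset.map_congr rfl fun r _ => ?_
    rw [Polynomial.map_comp, derivative_comp, eval_mul, eval_comp, derivative_map]
  rw [← Polynomial.map_comp, natDegree_map] at hchain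
  simp only [leadingCoeff_map, natDegree_map, hdeg', hlc', hN, map_mul, map_natCast] at hswap
  rw [polyDisc_eq_prod_eval_derivative _ (hN ▸ by nlinarith),
    polyDisc_eq_prod_eval_derivative _ hQ, ← hφ, hvals, hchain, hcrit, hN, hsign, hk,
    Nat.add_sub_cancel, map_pow,
    map_mul, map_pow, map_pow]
  set S := (((Q.comp f).map φ).roots.map ((derivative f).map φ).eval).prod
  set T := (((derivative f).map φ).roots.map ((Q.comp f).map φ).eval).prod
  set U := ((Q.map φ).roots.map fun x => (derivative (Q.map φ)).eval x).prod
  have hs : ((-1 : AlgebraicClosure K) ^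
      (Q.natDegree * (Q.natDegree - 1) / 2 * f.natDegree)) ^ 2 = 1 := by
    rw [← pow_mul, mul_comm, pow_mul]; simp
  rw [pow_add (φ (Q.comp f).leadingCoeff), pow_add (-1 : AlgebraicClosure K),
    pow_add (-1 : AlgebraicClosure K), mul_pow, mul_pow, ← pow_mul (-1 : AlgebraicClosure K),
    ← pow_mul (φ Q.leadingCoeff), mul_comm (Q.natDegree - 2)]
  generalize (-1 : AlgebraicClosure K) ^
      (Q.natDegree * (Q.natDegree - 1) / 2 * f.natDegree) = s at *
  generalize (-1 : AlgebraicClosure K) ^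
      (Q.natDegree * f.natDegree * (Q.natDegree * f.natDegree - 1) / 2) = t at *
  generalize (-1 : AlgebraicClosure K) ^
      (Q.natDegree * f.natDegree * (f.natDegree - 1)) = u at *
  rw [mul_pow] at hswap
  generalize φ Q.leadingCoeff ^ (f.natDegree * (Q.natDegree - 2)) = v at *
  generalize φ (Q.comp f).leadingCoeff ^ k = w at *
  generalize φ (Q.comp f).leadingCoeff ^ (f.natDegree - 1) = w' at *
  generalize φ f.leadingCoeff ^ (Q.natDegree * f.natDegree) = z at *
  generalize (f.natDegree : AlgebraicClosure K) ^ (Q.natDegree * f.natDegree) = y at *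
  linear_combination (t * v * w * U ^ f.natDegree) * hswap -
    (t * u * w * z * y * v * U ^ f.natDegree * T) * hs

/-- The exponent of the leading coefficient in the discriminant recursion. -/
lemma leadingCoeff_exponent (d n : ℕ) (hd : 2 ≤ d) (hn : 1 ≤ n) :
    (∑ i ∈ Finset.range (n + 1), d ^ i) * (d ^ n * d - 2 - (d - 1)) + d ^ n * d =
      (∑ i ∈ Finset.range n, d ^ i) * (d * (d ^ n - 2)) + (d ^ (2 * (n + 1) - 1) - 1) := by
  have hmul : (∑ i ∈ Finset.range n, d ^ i) * (d - 1) + 1 = d ^ n := by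
    have := geom_sum_mul_add (d - 1) n
    rwa [Nat.sub_add_cancel (by lia)] at this
  have hM : 2 ≤ d ^ n := hd.trans (Nat.le_self_pow (by lia) d)
  have hpow : d ^ (2 * (n + 1) - 1) = d ^ n * d ^ n * d := by
    rw [show 2 * (n + 1) - 1 = n + n + 1 by lia, pow_succ, pow_add]
  have hMd : 2 * d ≤ d ^ n * d := Nat.mul_le_mul_right _ hM
  have hpos : 1 ≤ d ^ n * d ^ n * d := Nat.pos_of_ne_zero (by positivity)
  rw [hpow, Finset.sum_range_succ]
  generalize (∑ i ∈ Finset.range n, d ^ i) = m at *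
  generalize d ^ n = M at *
  zify [show 1 ≤ d by lia, hM, hpos, show 2 ≤ M * d by lia,
    show d - 1 ≤ M * d - 2 by lia] at hmul ⊢
  linear_combination hmul

lemma neg_one_pow_eq_one_of_even_or_mod_four {L : Type} [Field L] (d n : ℕ) (hn : 2 ≤ n)
    (hd : Even d ∨ d % 4 = 1) :
    (-1 : L) ^ (d ^ n * (d ^ n - 1) / 2 + d ^ n * (d ^ (n - 1) - 1) / 2) = 1 := by
  apply Even.neg_one_pow
  have key : ∀ b, 4 ∣ d ^ n ∨ 4 ∣ b → Even (d ^ n * b / 2) := fun b h => by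
    obtain ⟨k, hk⟩ : 4 ∣ d ^ n * b := h.elim (·.mul_right _) (·.mul_left _)
    exact ⟨k, by lia⟩
  have hmod : ∀ m, d % 4 = 1 → 4 ∣ d ^ m - 1 := fun m h =>
    (Nat.modEq_iff_dvd' (Nat.pow_pos (by lia))).1
      (by simpa using ((show d ≡ 1 [MOD 4] from h).pow m).symm)
  rcases hd with hd | hd
  · have : 4 ∣ d ^ n := (pow_dvd_pow_of_dvd hd.two_dvd 2).trans (pow_dvd_pow d hn)
    exact (key _ (.inl this)).add (key _ (.inl this))
  · exact (key _ (.inr (hmod n hd))).add (key _ (.inr (hmod (n - 1) hd)))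

lemma neg_one_pow_eq_neg_one_of_mod_four {L : Type} [Field L] (d n : ℕ) (hn : 1 ≤ n)
    (hd : d % 4 = 3) :
    (-1 : L) ^ (d ^ n * (d ^ n - 1) / 2 + d ^ n * (d ^ (n - 1) - 1) / 2) = -1 := by
  apply Odd.neg_one_pow
  obtain ⟨m, rfl⟩ := Nat.exists_eq_add_of_le' hn
  rw [Nat.add_sub_cancel, pow_succ]
  have hM : d ^ m % 4 = 1 ∨ d ^ m % 4 = 3 := by
    induction m with
    | zero => simp
    | succ m ih =>
      rw [pow_succ, Nat.mul_mod, hd]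
      rcases ih (by lia) with h | h <;> simp [h]
  have hN : d ^ m * d % 4 = d ^ m % 4 * 3 % 4 := by rw [Nat.mul_mod, hd]
  generalize d ^ m * d = N at *
  generalize d ^ m = M at *
  have half : ∀ b, Even b → N * b / 2 = N * (b / 2) := fun b hb => Nat.mul_div_assoc _ hb.two_dvd
  have hodd : Odd N := Nat.odd_iff.2 (by lia)
  rw [half _ (Nat.even_iff.2 (by lia)), half _ (Nat.even_iff.2 (by lia)), ← mul_add]
  exact hodd.mul (Nat.odd_iff.2 (by lia))

end Arb

open Arb in
/-- The discriminant recursion for iterates: for `f` of degree `d ≥ 2` over a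
field `K` of characteristic zero, `α ∈ K` and `n ≥ 2`,
`disc(f^n - α) = (-1)^{A(d,n)} a_f^{d^{2n-1}-1} d^{d^n} disc(f^{n-1} - α)^d ∏_c (f^n(c) - α)`,
the product being over the critical points of `f` with multiplicity; moreover
`(-1)^{A(d,n)} = 1` iff `d` is even or `d ≡ 1 (mod 4)`. -/
theorem disc_iterate_formula {K : Type} [Field K] [CharZero K]
    (d : ℕ) (hd : 2 ≤ d) (f : K[X]) (hdeg : f.natDegree = d)
    (α : K) (n : ℕ) (hn : 2 ≤ n) :
    polyDisc (fIter f n - C α) =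
      (-1 : AlgebraicClosure K) ^ (d ^ n * (d ^ n - 1) / 2 + d ^ n * (d ^ (n - 1) - 1) / 2) *
        algebraMap K (AlgebraicClosure K) f.leadingCoeff ^ (d ^ (2 * n - 1) - 1) *
        (d : AlgebraicClosure K) ^ d ^ n *
        polyDisc (fIter f (n - 1) - C α) ^ d *
        (Multiset.map (fun c => aeval c (fIter f n) - algebraMap K (AlgebraicClosure K) α)
          ((derivative f).map (algebraMap K (AlgebraicClosure K))).roots).prod ∧
    ((Even d ∨ d % 4 = 1) →
      (-1 : AlgebraicClosure K) ^ (d ^ n * (d ^ n - 1) / 2 + d ^ n * (d ^ (n - 1) - 1) / 2)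
        = 1) ∧
    (d % 4 = 3 →
      (-1 : AlgebraicClosure K) ^ (d ^ n * (d ^ n - 1) / 2 + d ^ n * (d ^ (n - 1) - 1) / 2)
        = -1) := by
  refine ⟨?_, neg_one_pow_eq_one_of_even_or_mod_four d n hn,
    neg_one_pow_eq_neg_one_of_mod_four d n (by lia)⟩
  subst hdeg
  obtain ⟨m, rfl⟩ := Nat.exists_eq_add_of_le' (show 1 ≤ n by lia)
  have hm : 1 ≤ m := by lia
  have hf0 : f.natDegree ≠ 0 := by lia
  have hdeg : ∀ k, (fIter f k - C α).natDegree = f.natDegree ^ k := fun k => by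
    rw [natDegree_sub_C, natDegree_fIter]
  have hlc : ∀ k, (fIter f k - C α).leadingCoeff =
      f.leadingCoeff ^ (∑ i ∈ Finset.range k, f.natDegree ^ i) := fun k => by
    rw [leadingCoeff_sub_C _ (natDegree_fIter f k ▸ pow_ne_zero _ hf0), leadingCoeff_fIter f hf0]
  have hcomp : (fIter f m - C α).comp f = fIter f (m + 1) - C α := by
    rw [fIter_succ_eq_comp_right, sub_comp, C_comp]
  have hM : 2 ≤ f.natDegree ^ m := hd.trans (Nat.le_self_pow (by lia) _)
  have key := polyDisc_comp (fIter f m - C α) f hd (by rwa [hdeg])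
  have ha : algebraMap K (AlgebraicClosure K) f.leadingCoeff ≠ 0 := by
    rw [_root_.map_ne_zero, leadingCoeff_ne_zero]
    rintro rfl
    simp at hf0
  have heven : Even (f.natDegree ^ m * f.natDegree * (f.natDegree - 1)) := by
    rw [mul_assoc]
    exact (Nat.even_mul_pred_self _).mul_left _
  simp only [hcomp, hdeg, hlc, ← pow_mul, ← pow_add, leadingCoeff_exponent _ _ hd hm] at key
  rw [pow_add (-1 : AlgebraicClosure K) _ (_ * _ * (_ - 1)), heven.neg_one_pow, mul_one, map_pow,
    map_pow, pow_add (algebraMap K (AlgebraicClosure K) f.leadingCoeff)] at key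
  refine mul_left_cancel₀ (pow_ne_zero _ ha) (key.trans ?_)
  simp only [Nat.add_sub_cancel, pow_succ f.natDegree m, map_sub, aeval_C]
  ring
end
end
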